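/- Let r ≥ 1 and let k_1, …, k_r, M_1, …, M_r, N_1, …, N_r be positive integers with |M_i − N_i| ≤ k_i for each i = 1, …, r. Then for every real number x, ∑_{l ∈ ℤ} ( ∏_{i=1}^{r} C(M_i + N_i, M_i − k_i·l) ) · cos(l·x) ≥ 0. -/

import Mathlib

/-- Binomial coefficient `C(n, b)` with integer lower index, zero unless `0 ≤ b ≤ n`. -/
def zchoose (n : ℕ) (b : ℤ) : ℕ := if 0 ≤ b then n.choose b.toNat else 0

open Function Real Set

theorem zchoose_succ (n : ℕ) (b : ℤ) : zchoose (n + 1) b = zchoose n b + zchoose n (b - 1) := by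
  rcases lt_trichotomy b 0 with hb | rfl | hb
  · simp [zchoose, not_le.2 hb, show ¬ (1 : ℤ) ≤ b by lia]
  · simp [zchoose]
  · obtain ⟨m, rfl⟩ : ∃ m : ℕ, b = m + 1 := ⟨(b - 1).toNat, by lia⟩
    have h1 : (0 : ℤ) ≤ m + 1 := by lia
    have h2 : ((m : ℤ) + 1).toNat = m + 1 := by lia
    simp [zchoose, h1, h2, Nat.choose_succ_succ, add_comm]

theorem zchoose_symm (n : ℕ) (b : ℤ) : zchoose n (n - b) = zchoose n b := by
  unfold zchoose
  by_cases hb : 0 ≤ b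
  · by_cases hn : b ≤ n
    · obtain ⟨m, rfl⟩ := Int.eq_ofNat_of_zero_le hb
      have hm : m ≤ n := by exact_mod_cast hn
      have h2 : ((n : ℤ) - m).toNat = n - m := by lia
      simp only [sub_nonneg, Nat.cast_le, hm, if_true, h2, Int.natCast_nonneg, Int.toNat_natCast]
      exact Nat.choose_symm hm
    · rw [if_neg (by lia), if_pos hb, Nat.choose_eq_zero_of_lt (by lia)]
  · rw [if_neg hb]
    split_ifs
    · exact Nat.choose_eq_zero_of_lt (by lia)
    · rfl

theorem zchoose_eq_zero {n : ℕ} {b : ℤ} (h : b < 0 ∨ n < b) : zchoose n b = 0 := by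
  unfold zchoose
  split_ifs
  · exact Nat.choose_eq_zero_of_lt (by lia)
  · rfl

theorem mul_zchoose_succ (n : ℕ) (b : ℤ) :
    (b : ℝ) * zchoose (n + 1) b = (n + 1) * zchoose n (b - 1) := by
  rcases lt_trichotomy b 0 with hb | rfl | hb
  · simp [zchoose, not_le.2 hb, show ¬ (1 : ℤ) ≤ b by lia]
  · simp [zchoose]
  · obtain ⟨m, rfl⟩ : ∃ m : ℕ, b = m + 1 := ⟨(b - 1).toNat, by lia⟩
    have h1 : (0 : ℤ) ≤ m + 1 := by lia
    have h2 : ((m : ℤ) + 1).toNat = m + 1 := by lia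
    have := Nat.add_one_mul_choose_eq n m
    simp only [zchoose, h1, h2, if_true, add_sub_cancel_right, Int.natCast_nonneg,
      Int.toNat_natCast]
    push_cast
    have : ((n : ℝ) + 1) * n.choose m = (n + 1).choose (m + 1) * (m + 1) := by exact_mod_cast this
    linarith

theorem sub_two_mul_zchoose_succ (n : ℕ) (b : ℤ) :
    ((n : ℝ) + 1 - 2 * b) * zchoose (n + 1) b = (n + 1) * (zchoose n b - zchoose n (b - 1)) := by
  have h1 := mul_zchoose_succ n b
  have h2 : (zchoose (n + 1) b : ℝ) = zchoose n b + zchoose n (b - 1) := by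
    exact_mod_cast zchoose_succ n b
  linear_combination (n + 1 : ℝ) * h2 - 2 * h1

/-- The sequence `l ↦ C(n, m - k l)`. -/
def chooseSeq (k n : ℕ) (m l : ℤ) : ℝ := zchoose n (m - k * l)

theorem chooseSeq_nonneg (k n : ℕ) (m l : ℤ) : 0 ≤ chooseSeq k n m l := Nat.cast_nonneg _

theorem chooseSeq_eq_zero_of_lt {k : ℕ} (hk : 0 < k) {n : ℕ} {m l : ℤ} (h : |m| + n < |l|) :
    chooseSeq k n m l = 0 := by
  have hk' : (1 : ℤ) ≤ k := by exact_mod_cast hk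
  have : zchoose n (m - k * l) = 0 := by
    apply zchoose_eq_zero
    rcases le_total 0 l with hl | hl
    · rw [abs_of_nonneg hl] at h
      left
      nlinarith [le_abs_self m]
    · rw [abs_of_nonpos hl] at h
      right
      nlinarith [neg_abs_le m]
  simp [chooseSeq, this]

theorem finite_support_chooseSeq {k : ℕ} (hk : 0 < k) (n : ℕ) (m : ℤ) :
    (support (chooseSeq k n m)).Finite := by
  refine (Set.finite_Icc (-(|m| + n)) (|m| + n)).subset fun l hl => ?_
  by_contra hl'
  exact hl (chooseSeq_eq_zero_of_lt hk (by rw [Set.mem_Icc, ← abs_le] at hl'; lia))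

theorem chooseSeq_succ (k n : ℕ) (m l : ℤ) :
    chooseSeq k (n + 1) m l = chooseSeq k n m l + chooseSeq k n (m - 1) l := by
  unfold chooseSeq
  rw [zchoose_succ, show m - 1 - k * l = m - k * l - 1 by ring]
  push_cast
  ring

theorem chooseSeq_reflect (k n : ℕ) (m l : ℤ) :
    chooseSeq k n m (-1 - l) = chooseSeq k n (n - m - k) l := by
  unfold chooseSeq
  rw [← zchoose_symm]
  congr 2
  ring

theorem chooseSeq_add (k n : ℕ) (m l : ℤ) :
    chooseSeq k n (m + k) l = chooseSeq k n m (l - 1) := by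
  unfold chooseSeq
  congr 2
  ring

/-- The series `∑ c l cos ((l + 1/2) y)`. -/
noncomputable def cosSeries (c : ℤ → ℝ) (y : ℝ) : ℝ := ∑' l : ℤ, c l * cos ((l + 1 / 2) * y)

/-- The series `∑ c l sin ((l + 1/2) y)`. -/
noncomputable def sinSeries (c : ℤ → ℝ) (y : ℝ) : ℝ := ∑' l : ℤ, c l * sin ((l + 1 / 2) * y)

theorem summable_mul_of_finite {c : ℤ → ℝ} (hc : (support c).Finite) (f : ℤ → ℝ) :
    Summable fun l => c l * f l :=
  summable_of_hasFiniteSupport (hc.subset (support_mul_subset_left _ _))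

theorem tsum_mul_eq_sum {c : ℤ → ℝ} (hc : (support c).Finite) (f : ℤ → ℝ) :
    ∑' l, c l * f l = ∑ l ∈ hc.toFinset, c l * f l :=
  tsum_eq_sum fun l hl => by simp at hl; simp [hl]

theorem tsum_reflect (f : ℤ → ℝ) : ∑' l, f (-1 - l) = ∑' l, f l :=
  (Equiv.subLeft (-1 : ℤ)).tsum_eq f

theorem tsum_shift (f : ℤ → ℝ) : ∑' l, f (l - 1) = ∑' l, f l :=
  (Equiv.subRight (1 : ℤ)).tsum_eq f

theorem sinSeries_eq_neg_of_reflect {c d : ℤ → ℝ} (h : ∀ l, c (-1 - l) = d l) (y : ℝ) :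
    sinSeries c y = -sinSeries d y := by
  unfold sinSeries
  rw [← tsum_reflect, ← tsum_neg]
  refine tsum_congr fun l => ?_
  rw [h, show (((-1 - l : ℤ) : ℝ) + 1 / 2) * y = -((l + 1 / 2) * y) by push_cast; ring, sin_neg]
  ring

theorem sinSeries_eq_zero {c : ℤ → ℝ} (h : ∀ l, c (-1 - l) = c l) (y : ℝ) : sinSeries c y = 0 := by
  have := sinSeries_eq_neg_of_reflect h y
  linarith

theorem sinSeries_add {c d : ℤ → ℝ} (hc : (support c).Finite) (hd : (support d).Finite) (y : ℝ) :
    sinSeries (fun l => c l + d l) y = sinSeries c y + sinSeries d y := by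
  unfold sinSeries
  rw [← (summable_mul_of_finite hc _).tsum_add (summable_mul_of_finite hd _)]
  exact tsum_congr fun l => by ring

theorem continuous_cosSeries {c : ℤ → ℝ} (hc : (support c).Finite) : Continuous (cosSeries c) := by
  unfold cosSeries
  simp_rw [tsum_mul_eq_sum hc]
  fun_prop

theorem continuous_sinSeries {c : ℤ → ℝ} (hc : (support c).Finite) : Continuous (sinSeries c) := by
  unfold sinSeries
  simp_rw [tsum_mul_eq_sum hc]
  fun_prop

theorem finite_support_half_mul {c : ℤ → ℝ} (hc : (support c).Finite) :
    (support fun l : ℤ => ((l : ℝ) + 1 / 2) * c l).Finite :=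
  hc.subset (support_mul_subset_right _ _)

theorem hasDerivAt_cosSeries {c : ℤ → ℝ} (hc : (support c).Finite) (y : ℝ) :
    HasDerivAt (cosSeries c) (-sinSeries (fun l => (l + 1 / 2) * c l) y) y := by
  have h1 : cosSeries c = fun y => ∑ l ∈ hc.toFinset, c l * cos ((l + 1 / 2) * y) := by
    ext y
    exact tsum_mul_eq_sum hc _
  have h2 : -sinSeries (fun l => (l + 1 / 2) * c l) y =
      ∑ l ∈ hc.toFinset, c l * (-sin ((l + 1 / 2) * y) * ((l + 1 / 2) * 1)) := by
    unfold sinSeries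
    rw [← tsum_mul_eq_sum hc, ← tsum_neg]
    exact tsum_congr fun l => by ring
  rw [h1, h2]
  exact HasDerivAt.fun_sum fun l _ => (((hasDerivAt_id y).const_mul _).cos).const_mul _

theorem cosSeries_neg (c : ℤ → ℝ) (y : ℝ) : cosSeries c (-y) = cosSeries c y := by
  simp [cosSeries]

theorem cosSeries_add_pi (c : ℤ → ℝ) (y : ℝ) : cosSeries c (π + y) = -cosSeries c (π - y) := by
  unfold cosSeries
  rw [← tsum_neg]
  refine tsum_congr fun l => ?_
  rw [show ((l : ℝ) + 1 / 2) * (π + y) = (π - (l + 1 / 2) * (π - y)) + l * (2 * π) by ring,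
    cos_add_int_mul_two_pi, cos_pi_sub]
  ring

theorem cosSeries_pi (c : ℤ → ℝ) : cosSeries c π = 0 := by
  have := cosSeries_add_pi c 0
  simp at this
  linarith

theorem sinSeries_neg (c : ℤ → ℝ) (y : ℝ) : sinSeries c (-y) = -sinSeries c y := by
  unfold sinSeries
  rw [← tsum_neg]
  exact tsum_congr fun l => by rw [mul_neg, sin_neg]; ring

/-- A nonnegative, finitely supported sequence, symmetric about `-1/2`, whose half-integer cosine
series is decreasing on `[0, π]`. -/
structure HalfBell (c : ℤ → ℝ) : Prop where
  finite : (support c).Finite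
  nonneg : ∀ l, 0 ≤ c l
  reflect : ∀ l, c (-1 - l) = c l
  slope : ∀ y ∈ Icc 0 π, 0 ≤ sinSeries (fun l => (l + 1 / 2) * c l) y

theorem antitoneOn_cosSeries {c : ℤ → ℝ} (hc : (support c).Finite)
    (h : ∀ y ∈ Icc 0 π, 0 ≤ sinSeries (fun l => (l + 1 / 2) * c l) y) :
    AntitoneOn (cosSeries c) (Icc 0 π) := by
  refine antitoneOn_of_deriv_nonpos (convex_Icc _ _) (continuous_cosSeries hc).continuousOn
    (fun y _ => (hasDerivAt_cosSeries hc y).differentiableAt.differentiableWithinAt) fun y hy => ?_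
  rw [(hasDerivAt_cosSeries hc y).deriv]
  linarith [h y (interior_subset hy)]

theorem cosSeries_nonneg {c : ℤ → ℝ} (hc : (support c).Finite)
    (h : ∀ y ∈ Icc 0 π, 0 ≤ sinSeries (fun l => (l + 1 / 2) * c l) y) {y : ℝ} (hy : y ∈ Icc 0 π) :
    0 ≤ cosSeries c y := by
  rw [← cosSeries_pi c]
  exact antitoneOn_cosSeries hc h hy ⟨pi_pos.le, le_rfl⟩ hy.2

theorem slope_chooseSeq {k : ℕ} (hk : 0 < k) {n : ℕ} {m : ℤ} (h : (n + 1 : ℤ) = 2 * m + k)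
    (y : ℝ) : sinSeries (fun l => (l + 1 / 2) * chooseSeq k (n + 1) m l) y =
      (n + 1) / k * sinSeries (chooseSeq k n m) y := by
  have hk' : (k : ℝ) ≠ 0 := by positivity
  have h' : (n + 1 : ℝ) = 2 * m + k := by exact_mod_cast h
  have h1 : sinSeries (fun l => (l + 1 / 2) * chooseSeq k (n + 1) m l) y =
      (n + 1) / (2 * k) * (sinSeries (chooseSeq k n m) y - sinSeries (chooseSeq k n (m - 1)) y) := by
    unfold sinSeries
    rw [← (summable_mul_of_finite (finite_support_chooseSeq hk _ _) _).tsum_sub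
      (summable_mul_of_finite (finite_support_chooseSeq hk _ _) _), ← tsum_mul_left]
    refine tsum_congr fun l => ?_
    have := sub_two_mul_zchoose_succ n (m - k * l)
    push_cast at this
    have h2 : ((l : ℝ) + 1 / 2) * chooseSeq k (n + 1) m l =
        (n + 1) / (2 * k) * (chooseSeq k n m l - chooseSeq k n (m - 1) l) := by
      unfold chooseSeq
      rw [show m - 1 - k * l = m - k * l - 1 by ring]
      field_simp
      rw [← this, h']
      ring
    beta_reduce
    rw [h2]
    ring
  have h2 : sinSeries (chooseSeq k n (m - 1)) y = -sinSeries (chooseSeq k n m) y :=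
    sinSeries_eq_neg_of_reflect (fun l => by rw [chooseSeq_reflect]; congr 1; lia) y
  rw [h1, h2]
  field_simp
  ring

theorem sinSeries_chooseSeq_nonneg {k : ℕ} (hk : 0 < k) (n : ℕ) :
    ∀ m : ℤ, |(n : ℤ) - 2 * m| ≤ k → ∀ y ∈ Icc 0 π, 0 ≤ sinSeries (chooseSeq k n m) y := by
  induction n with
  | zero =>
    intro m hm y hy
    have hs : sinSeries (chooseSeq k 0 m) y = chooseSeq k 0 m 0 * sin (y / 2) := by
      unfold sinSeries
      rw [tsum_eq_single 0]
      · norm_num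
        left; ring_nf
      · intro l hl
        have : zchoose 0 (m - k * l) = 0 := by
          apply zchoose_eq_zero
          by_contra! hcon
          have h0 : m = k * l := by push_cast at hcon; lia
          rw [h0] at hm
          have h1 : |(l : ℤ)| ≥ 1 := Int.one_le_abs hl
          rw [show ((0 : ℕ) : ℤ) - 2 * (k * l) = -(2 * k * l) by push_cast; ring, abs_neg, abs_mul,
            abs_of_nonneg (by positivity : (0 : ℤ) ≤ 2 * k)] at hm
          have : (0 : ℤ) < k := by exact_mod_cast hk
          nlinarith
        simp [chooseSeq, this]
    rw [hs]
    exact mul_nonneg (chooseSeq_nonneg _ _ _ _)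
      (sin_nonneg_of_nonneg_of_le_pi (by linarith [hy.1]) (by linarith [hy.1, hy.2]))
  | succ n ih =>
    intro m hm y hy
    rw [abs_le] at hm
    push_cast at hm
    rcases eq_or_ne (n + 1 - 2 * m : ℤ) k with h1 | h1
    · rw [sinSeries_eq_zero fun l => by rw [chooseSeq_reflect]; congr 1; push_cast; lia]
    rcases eq_or_ne (n + 1 - 2 * m : ℤ) (-k) with h2 | h2
    · obtain ⟨m', rfl⟩ : ∃ m', m = m' + k := ⟨m - k, by ring⟩
      have hfin := finite_support_chooseSeq hk (n + 1) m'
      have hp : 0 ≤ cosSeries (chooseSeq k (n + 1) m') y := by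
        refine cosSeries_nonneg hfin (fun z hz => ?_) hy
        rw [slope_chooseSeq hk (by lia)]
        exact mul_nonneg (by positivity) (ih m' (by rw [abs_le]; lia) z hz)
      have h0 : sinSeries (chooseSeq k (n + 1) m') y = 0 :=
        sinSeries_eq_zero (fun l => by rw [chooseSeq_reflect]; congr 1; push_cast; lia) y
      have : sinSeries (chooseSeq k (n + 1) (m' + k)) y =
          sin y * cosSeries (chooseSeq k (n + 1) m') y
            + cos y * sinSeries (chooseSeq k (n + 1) m') y := by
        unfold sinSeries cosSeries
        rw [← tsum_mul_left, ← tsum_mul_left, ← Summable.tsum_add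
          ((summable_mul_of_finite hfin _).mul_left _) ((summable_mul_of_finite hfin _).mul_left _)]
        conv_rhs => rw [← tsum_shift]
        refine tsum_congr fun l => ?_
        rw [chooseSeq_add, show ((l : ℝ) + 1 / 2) * y = y + (((l - 1 : ℤ) : ℝ) + 1 / 2) * y by
          push_cast; ring, sin_add]
        ring
      rw [this, h0, mul_zero, add_zero]
      exact mul_nonneg (sin_nonneg_of_nonneg_of_le_pi hy.1 hy.2) hp
    · have : sinSeries (chooseSeq k (n + 1) m) y =
          sinSeries (chooseSeq k n m) y + sinSeries (chooseSeq k n (m - 1)) y := by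
        rw [← sinSeries_add (finite_support_chooseSeq hk _ _) (finite_support_chooseSeq hk _ _)]
        congr 1
        exact funext fun l => chooseSeq_succ k n m l
      rw [this]
      exact add_nonneg (ih _ (by rw [abs_le]; lia) y hy) (ih _ (by rw [abs_le]; lia) y hy)

theorem halfBell_chooseSeq {k : ℕ} (hk : 0 < k) {n : ℕ} {m : ℤ} (h : (n : ℤ) = 2 * m + k) :
    HalfBell (chooseSeq k n m) where
  finite := finite_support_chooseSeq hk n m
  nonneg := chooseSeq_nonneg k n m
  reflect l := by rw [chooseSeq_reflect]; congr 1; lia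
  slope y hy := by
    cases n with
    | zero =>
      have : (fun l : ℤ => ((l : ℝ) + 1 / 2) * chooseSeq k 0 m l) = fun _ => 0 := by
        ext l
        have : zchoose 0 (m - k * l) = 0 := by
          apply zchoose_eq_zero
          by_contra! hcon
          have h0 : m = k * l := by push_cast at hcon; lia
          have h1 : (k : ℤ) * (2 * l + 1) = 0 := by push_cast at h; linarith
          rcases mul_eq_zero.1 h1 with h2 | h2 <;> lia
        simp [chooseSeq, this]
      rw [this]
      simp [sinSeries]
    | succ n =>
      rw [slope_chooseSeq hk (by push_cast at h; lia)]
      exact mul_nonneg (by positivity)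
        (sinSeries_chooseSeq_nonneg hk n m (by rw [abs_le]; push_cast at h; lia) y hy)

theorem integral_cos_add_int_mul (N : ℤ) (A : ℝ) :
    ∫ y in -π..π, cos (A + N * y) = if N = 0 then 2 * π * cos A else 0 := by
  split_ifs with hN
  · simp [hN]
    left; ring
  · have hN' : (N : ℝ) ≠ 0 := by exact_mod_cast hN
    rw [intervalIntegral.integral_comp_add_mul cos hN', integral_cos,
      show A + N * π = A + N * -π + N * (2 * π) by ring, sin_add_int_mul_two_pi]
    simp

theorem integral_sin_add_int_mul (N : ℤ) (A : ℝ) :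
    ∫ y in -π..π, sin (A + N * y) = if N = 0 then 2 * π * sin A else 0 := by
  have := integral_cos_add_int_mul N (A - π / 2)
  simpa only [show ∀ y : ℝ, A - π / 2 + N * y = A + N * y - π / 2 by intro y; ring,
    cos_sub_pi_div_two] using this

theorem integral_mul_tsum {c : ℤ → ℝ} (hc : (support c).Finite) {φ : ℝ → ℝ} (hφ : Continuous φ)
    {f : ℤ → ℝ → ℝ} (hf : ∀ l, Continuous (f l)) (a b : ℝ) :
    ∫ y in a..b, φ y * ∑' l, c l * f l y = ∑' l, c l * ∫ y in a..b, φ y * f l y := by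
  rw [tsum_mul_eq_sum hc]
  simp_rw [tsum_mul_eq_sum hc, Finset.mul_sum, ← intervalIntegral.integral_const_mul]
  rw [intervalIntegral.integral_finsetSum fun l _ => Continuous.intervalIntegrable
    (by have := hf l; fun_prop) _ _]
  exact Finset.sum_congr rfl fun l _ => intervalIntegral.integral_congr fun y _ => by
    ring

theorem integral_sin_mul_cosSeries {d : ℤ → ℝ} (hd : (support d).Finite)
    (hdr : ∀ l, d (-1 - l) = d l) (l : ℤ) (x : ℝ) :
    ∫ y in -π..π, sin ((l + 1 / 2) * y) * cosSeries d (x - y) =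
      2 * π * (d l * sin ((l + 1 / 2) * x)) := by
  have key : ∀ m : ℤ, d m * ∫ y in -π..π, sin ((l + 1 / 2) * y) * cos ((m + 1 / 2) * (x - y)) =
      (if m = l then π * (d l * sin ((l + 1 / 2) * x)) else 0) +
        if m = -1 - l then π * (d l * sin ((l + 1 / 2) * x)) else 0 := by
    intro m
    have h1 : ∀ y : ℝ, sin ((l + 1 / 2) * y) * cos ((m + 1 / 2) * (x - y)) =
        1 / 2 * (sin ((m + 1 / 2) * x + (l - m : ℤ) * y) +
          sin (-((m + 1 / 2) * x) + (l + m + 1 : ℤ) * y)) := by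
      intro y
      rw [show (m + 1 / 2) * x + (l - m : ℤ) * y = (l + 1 / 2) * y + (m + 1 / 2) * (x - y) by
        push_cast; ring, show -((m + 1 / 2) * x) + (l + m + 1 : ℤ) * y =
        (l + 1 / 2) * y - (m + 1 / 2) * (x - y) by push_cast; ring, sin_add, sin_sub]
      ring
    simp_rw [h1]
    rw [intervalIntegral.integral_const_mul, intervalIntegral.integral_add
      (Continuous.intervalIntegrable (by fun_prop) _ _)
      (Continuous.intervalIntegrable (by fun_prop) _ _),
      integral_sin_add_int_mul, integral_sin_add_int_mul, mul_add, mul_add]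
    congr 1
    · by_cases h : m = l
      · subst h; simp; ring
      · rw [if_neg (by lia), if_neg h]; ring
    · by_cases h : m = -1 - l
      · subst h
        rw [if_pos (by ring), if_pos rfl, hdr,
          show -((((-1 - l : ℤ) : ℝ) + 1 / 2) * x) = (l + 1 / 2) * x by push_cast; ring]
        ring
      · rw [if_neg (by lia), if_neg h]; ring
  unfold cosSeries
  rw [integral_mul_tsum hd (by fun_prop) (fun m => by fun_prop), tsum_congr key,
    ((hasSum_ite_eq l _).add (hasSum_ite_eq (-1 - l) _)).tsum_eq]
  ring

theorem integral_sinSeries_mul_cosSeries {c d : ℤ → ℝ} (hc : (support c).Finite)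
    (hd : (support d).Finite) (hdr : ∀ l, d (-1 - l) = d l) (x : ℝ) :
    ∫ y in -π..π, cosSeries d (x - y) * sinSeries c y =
      2 * π * sinSeries (fun l => c l * d l) x := by
  have hcont := continuous_cosSeries hd
  unfold sinSeries
  rw [integral_mul_tsum hc (by fun_prop) (fun m => by fun_prop), ← tsum_mul_left]
  refine tsum_congr fun l => ?_
  simp_rw [mul_comm (cosSeries d _)]
  rw [integral_sin_mul_cosSeries hd hdr]
  ring

namespace HalfBell

variable {c d : ℤ → ℝ}

theorem antitoneOn (hc : HalfBell c) : AntitoneOn (cosSeries c) (Icc 0 π) :=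
  antitoneOn_cosSeries hc.finite hc.slope

theorem cosSeries_nonneg (hc : HalfBell c) {y : ℝ} (h0 : 0 ≤ y) (h1 : y ≤ π) :
    0 ≤ cosSeries c y :=
  _root_.cosSeries_nonneg hc.finite hc.slope ⟨h0, h1⟩

theorem cosSeries_abs (y : ℝ) : cosSeries c |y| = cosSeries c y := by
  rcases abs_choice y with h | h <;> rw [h]
  exact cosSeries_neg c y

theorem cosSeries_nonpos (hc : HalfBell c) {y : ℝ} (h0 : π ≤ y) (h1 : y ≤ 2 * π) :
    cosSeries c y ≤ 0 := by
  have h2 := cosSeries_add_pi c (y - π)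
  rw [add_sub_cancel] at h2
  have := hc.cosSeries_nonneg (y := π - (y - π)) (by linarith) (by linarith)
  linarith

theorem cosSeries_add_le_cosSeries_sub (hc : HalfBell c) {x y : ℝ} (hx : x ∈ Icc 0 π)
    (hy : y ∈ Icc 0 π) : cosSeries c (x + y) ≤ cosSeries c (x - y) := by
  obtain ⟨hx0, hx1⟩ := hx
  obtain ⟨hy0, hy1⟩ := hy
  rw [← cosSeries_abs (x - y)]
  have hle : |x - y| ≤ π := abs_le.2 ⟨by linarith, by linarith⟩
  rcases le_total (x + y) π with h | h
  · exact hc.antitoneOn ⟨abs_nonneg _, hle⟩ ⟨by linarith, h⟩ (abs_le.2 ⟨by linarith, by linarith⟩)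
  · exact (hc.cosSeries_nonpos h (by linarith)).trans (hc.cosSeries_nonneg (abs_nonneg _) hle)

theorem mul (hc : HalfBell c) (hd : HalfBell d) : HalfBell fun l => c l * d l where
  finite := hc.finite.subset (support_mul_subset_left _ _)
  nonneg l := mul_nonneg (hc.nonneg l) (hd.nonneg l)
  reflect l := by rw [hc.reflect, hd.reflect]
  slope x hx := by
    have hfin := finite_support_half_mul hc.finite
    have hs := continuous_sinSeries hfin
    have hq := continuous_cosSeries hd.finite
    have h := integral_sinSeries_mul_cosSeries hfin hd.finite hd.reflect x
    have hassoc : (fun l : ℤ => ((l : ℝ) + 1 / 2) * (c l * d l)) =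
        fun l => (l + 1 / 2) * c l * d l := funext fun l => (mul_assoc _ _ _).symm
    rw [hassoc]
    rw [← intervalIntegral.integral_add_adjacent_intervals (b := 0)
      (Continuous.intervalIntegrable (by fun_prop) _ _)
      (Continuous.intervalIntegrable (by fun_prop) _ _)] at h
    have h2 := intervalIntegral.integral_comp_neg (a := 0) (b := π) fun y =>
      cosSeries d (x - y) * sinSeries (fun l => (l + 1 / 2) * c l) y
    rw [neg_zero] at h2
    rw [← h2, ← intervalIntegral.integral_add (Continuous.intervalIntegrable (by fun_prop) _ _)
      (Continuous.intervalIntegrable (by fun_prop) _ _)] at h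
    refine nonneg_of_mul_nonneg_right (h ▸ ?_) (mul_pos two_pos pi_pos)
    refine intervalIntegral.integral_nonneg pi_pos.le fun y hy => ?_
    rw [sinSeries_neg, sub_neg_eq_add]
    have h3 := mul_nonneg (sub_nonneg.2 (hd.cosSeries_add_le_cosSeries_sub hx hy)) (hc.slope y hy)
    linarith

theorem cosSeries_mul_le (hc : HalfBell c) (hd : HalfBell d) {h y : ℝ} (hh : h ∈ Icc 0 (π / 2))
    (hy : y ∈ Icc 0 (π / 2)) :
    cosSeries d (h - (π - y)) * cosSeries c (h + (π - y)) ≤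
      cosSeries d (h - y) * cosSeries c (h + y) := by
  obtain ⟨hh0, hh1⟩ := hh
  obtain ⟨hy0, hy1⟩ := hy
  have hleft : cosSeries d (h - (π - y)) = cosSeries d (π - h - y) := by
    rw [← cosSeries_neg]; congr 1; ring
  have h1 : 0 ≤ cosSeries d (π - h - y) := hd.cosSeries_nonneg (by linarith) (by linarith)
  have h2 : 0 ≤ cosSeries c (h + y) := hc.cosSeries_nonneg (by linarith) (by linarith)
  rw [hleft]
  rcases le_total y h with hyh | hyh
  · have h3 : 0 ≤ cosSeries d (h - y) := hd.cosSeries_nonneg (by linarith) (by linarith)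
    have h4 : cosSeries c (h + (π - y)) ≤ 0 := hc.cosSeries_nonpos (by linarith) (by linarith)
    exact (mul_nonpos_of_nonneg_of_nonpos h1 h4).trans (mul_nonneg h3 h2)
  · have h3 : cosSeries d (π - h - y) ≤ cosSeries d (h - y) := by
      rw [← cosSeries_neg d (h - y)]
      exact hd.antitoneOn ⟨by linarith, by linarith⟩ ⟨by linarith, by linarith⟩ (by linarith)
    have h4 : cosSeries c (h + (π - y)) ≤ cosSeries c (h + y) :=
      hc.antitoneOn ⟨by linarith, by linarith⟩ ⟨by linarith, by linarith⟩ (by linarith)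
    exact (mul_le_mul_of_nonneg_left h4 h1).trans (mul_le_mul_of_nonneg_right h3 h2)

theorem integral_nonneg (hc : HalfBell c) (hd : HalfBell d) {h : ℝ} (hh : h ∈ Icc 0 (π / 2)) :
    0 ≤ ∫ y in (0 : ℝ)..π, cos y * cosSeries d (h - y) * cosSeries c (h + y) := by
  have hp := continuous_cosSeries hc.finite
  have hq := continuous_cosSeries hd.finite
  rw [← intervalIntegral.integral_add_adjacent_intervals (b := π / 2)
      (Continuous.intervalIntegrable (by fun_prop) _ _)
      (Continuous.intervalIntegrable (by fun_prop) _ _)]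
  have h2 := intervalIntegral.integral_comp_sub_left (a := 0) (b := π / 2) (fun y =>
      cos y * cosSeries d (h - y) * cosSeries c (h + y)) π
  rw [sub_zero, show π - π / 2 = π / 2 by ring] at h2
  rw [← h2, ← intervalIntegral.integral_add (Continuous.intervalIntegrable (by fun_prop) _ _)
      (Continuous.intervalIntegrable (by fun_prop) _ _)]
  refine intervalIntegral.integral_nonneg (by positivity) fun y hy => ?_
  rw [cos_pi_sub]
  have h3 := mul_nonneg (cos_nonneg_of_mem_Icc ⟨by linarith [hy.1, pi_pos], hy.2⟩)
    (sub_nonneg.2 (hc.cosSeries_mul_le hd hh hy))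
  linarith

theorem integral_cos_mul_cos_mul_cosSeries (hd : HalfBell d) (l : ℤ) (h : ℝ) :
    ∫ y in -π..π, cos y * cos ((l + 1 / 2) * (h + y)) * cosSeries d (h - y) =
      π * (d (l - 1) * cos (l * (2 * h)) + d (l + 1) * cos ((l + 1) * (2 * h))) := by
  set a : ℝ := π / 2 * (d (l - 1) * cos (l * (2 * h))) with ha
  set b : ℝ := π / 2 * (d (l + 1) * cos ((l + 1) * (2 * h))) with hb
  have key : ∀ m : ℤ, d m * ∫ y in -π..π, cos y * cos ((l + 1 / 2) * (h + y)) *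
      cos ((m + 1 / 2) * (h - y)) =
      ((if m = l + 1 then b else 0) + (if m = l - 1 then a else 0)) +
        ((if m = -1 - (l + 1) then b else 0) + (if m = -1 - (l - 1) then a else 0)) := by
    intro m
    have h1 : ∀ y : ℝ, cos y * cos ((l + 1 / 2) * (h + y)) * cos ((m + 1 / 2) * (h - y)) =
        1 / 4 * ((cos ((l + m + 1) * h + (l - m + 1 : ℤ) * y) +
          cos ((l + m + 1) * h + (l - m - 1 : ℤ) * y)) +
          (cos ((l - m) * h + (l + m + 2 : ℤ) * y) + cos ((l - m) * h + (l + m : ℤ) * y))) := by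
      intro y
      set u := (l + 1 / 2) * (h + y) with hu
      set v := (m + 1 / 2) * (h - y) with hv
      rw [show (l + m + 1) * h + (l - m + 1 : ℤ) * y = u + v + y by push_cast; ring,
        show (l + m + 1) * h + (l - m - 1 : ℤ) * y = u + v - y by push_cast; ring,
        show (l - m) * h + (l + m + 2 : ℤ) * y = u - v + y by push_cast; ring,
        show (l - m) * h + (l + m : ℤ) * y = u - v - y by push_cast; ring,
        cos_add (u + v), cos_sub (u + v), cos_add (u - v), cos_sub (u - v), cos_add u, cos_sub u]
      ring
    simp_rw [h1]
    have hI : ∀ A B : ℝ, IntervalIntegrable (fun y => cos (A + B * y)) MeasureTheory.volume (-π) π :=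
      fun A B => Continuous.intervalIntegrable (by fun_prop) _ _
    rw [intervalIntegral.integral_const_mul, intervalIntegral.integral_add
      ((hI _ _).add (hI _ _)) ((hI _ _).add (hI _ _)), intervalIntegral.integral_add (hI _ _)
      (hI _ _), intervalIntegral.integral_add (hI _ _) (hI _ _)]
    simp only [integral_cos_add_int_mul, mul_add]
    congr 1
    · congr 1
      · by_cases hm : m = l + 1
        · subst hm
          rw [if_pos (by ring), if_pos rfl, hb]
          push_cast
          ring_nf
        · rw [if_neg (by lia), if_neg hm]; ring
      · by_cases hm : m = l - 1
        · subst hm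
          rw [if_pos (by ring), if_pos rfl, ha]
          push_cast
          ring_nf
        · rw [if_neg (by lia), if_neg hm]; ring
    · congr 1
      · by_cases hm : m = -1 - (l + 1)
        · subst hm
          rw [if_pos (by ring), if_pos rfl, hb, hd.reflect]
          push_cast
          ring_nf
        · rw [if_neg (by lia), if_neg hm]; ring
      · by_cases hm : m = -1 - (l - 1)
        · subst hm
          rw [if_pos (by ring), if_pos rfl, ha, hd.reflect]
          push_cast
          ring_nf
        · rw [if_neg (by lia), if_neg hm]; ring
  rw [show (fun y => cos y * cos ((l + 1 / 2) * (h + y)) * cosSeries d (h - y)) = fun y =>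
    cos y * cos ((l + 1 / 2) * (h + y)) * ∑' m : ℤ, d m * cos ((m + 1 / 2) * (h - y)) from rfl,
    integral_mul_tsum hd.finite (by fun_prop) (fun m => by fun_prop), tsum_congr key,
    (((hasSum_ite_eq _ _).add (hasSum_ite_eq _ _)).add
      ((hasSum_ite_eq _ _).add (hasSum_ite_eq _ _))).tsum_eq]
  ring

theorem integral_cos_mul_cosSeries_mul_cosSeries (hc : HalfBell c) (hd : HalfBell d) (h : ℝ) :
    ∫ y in -π..π, cos y * cosSeries d (h - y) * cosSeries c (h + y) =
      2 * π * ∑' l : ℤ, c l * d (l - 1) * cos (l * (2 * h)) := by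
  have hq := continuous_cosSeries hd.finite
  rw [show (fun y => cos y * cosSeries d (h - y) * cosSeries c (h + y)) = fun y =>
    cos y * cosSeries d (h - y) * ∑' m : ℤ, c m * cos ((m + 1 / 2) * (h + y)) from rfl,
    integral_mul_tsum hc.finite (by fun_prop) (fun m => by fun_prop)]
  simp_rw [mul_right_comm (cos _) (cosSeries d _), hd.integral_cos_mul_cos_mul_cosSeries]
  have h1 : ∀ l : ℤ, c l * (π * (d (l - 1) * cos (l * (2 * h)) +
      d (l + 1) * cos ((l + 1) * (2 * h)))) =
      π * (c l * (d (l - 1) * cos (l * (2 * h)))) +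
      π * (c l * (d (l + 1) * cos ((l + 1) * (2 * h)))) := fun l => by ring
  rw [tsum_congr h1, ((summable_mul_of_finite hc.finite _).mul_left _).tsum_add
    ((summable_mul_of_finite hc.finite _).mul_left _), tsum_mul_left, tsum_mul_left]
  have h2 : ∑' l : ℤ, c l * (d (l + 1) * cos ((l + 1) * (2 * h))) =
      ∑' l : ℤ, c l * (d (l - 1) * cos (l * (2 * h))) := by
    rw [← tsum_reflect]
    refine tsum_congr fun l => ?_
    rw [hc.reflect, show -1 - l + 1 = -1 - (l - 1) by ring, hd.reflect,
      show ((-1 - l : ℤ) + 1 : ℝ) * (2 * h) = -(l * (2 * h)) by push_cast; ring, cos_neg]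
  rw [h2]
  simp_rw [mul_assoc]
  ring

theorem tsum_mul_shift_nonneg (hc : HalfBell c) (hd : HalfBell d) {x : ℝ} (hx : x ∈ Icc 0 π) :
    0 ≤ ∑' l : ℤ, c l * d (l - 1) * cos (l * x) := by
  have hp := continuous_cosSeries hc.finite
  have hq := continuous_cosSeries hd.finite
  have hh : x / 2 ∈ Icc 0 (π / 2) := ⟨by linarith [hx.1], by linarith [hx.2]⟩
  have h := hc.integral_cos_mul_cosSeries_mul_cosSeries hd (x / 2)
  rw [← intervalIntegral.integral_add_adjacent_intervals (b := 0)
      (Continuous.intervalIntegrable (by fun_prop) _ _)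
      (Continuous.intervalIntegrable (by fun_prop) _ _)] at h
  have h2 := intervalIntegral.integral_comp_neg (a := 0) (b := π) fun y =>
    cos y * cosSeries d (x / 2 - y) * cosSeries c (x / 2 + y)
  rw [neg_zero] at h2
  have h3 := hd.integral_nonneg hc hh
  simp_rw [← h2, cos_neg, sub_neg_eq_add, ← sub_eq_add_neg] at h
  rw [show 2 * (x / 2) = x by ring] at h
  refine nonneg_of_mul_nonneg_right (h ▸ add_nonneg ?_ (hc.integral_nonneg hd hh))
    (mul_pos two_pos pi_pos)
  simpa only [mul_right_comm _ (cosSeries c _)] using h3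

theorem tsum_nonneg (hc : HalfBell c) {x : ℝ} (hx : x ∈ Icc 0 π) :
    0 ≤ ∑' l : ℤ, c l * cos (l * x) := by
  have h : ∑' l : ℤ, c l * cos (l * x) =
      cos (x / 2) * cosSeries c x + sin (x / 2) * sinSeries c x := by
    unfold cosSeries sinSeries
    rw [← tsum_mul_left, ← tsum_mul_left, ← Summable.tsum_add
      ((summable_mul_of_finite hc.finite _).mul_left _)
      ((summable_mul_of_finite hc.finite _).mul_left _)]
    refine tsum_congr fun l => ?_
    rw [show (l : ℝ) * x = (l + 1 / 2) * x - x / 2 by ring, cos_sub]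
    ring
  rw [h, sinSeries_eq_zero hc.reflect, mul_zero, add_zero]
  exact mul_nonneg (cos_nonneg_of_mem_Icc ⟨by linarith [hx.1, pi_pos], by linarith [hx.2]⟩)
    (hc.cosSeries_nonneg hx.1 hx.2)

theorem tsum_shift_nonneg (hc : HalfBell c) {x : ℝ} (hx : x ∈ Icc 0 π) :
    0 ≤ ∑' l : ℤ, c (l - 1) * cos (l * x) := by
  have h := hc.tsum_nonneg hx
  rw [← tsum_reflect, ← tsum_shift] at h
  refine h.trans_eq (tsum_congr fun l => ?_)
  rw [hc.reflect, show ((-1 - (l - 1) : ℤ) : ℝ) * x = -(l * x) by push_cast; ring, cos_neg]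

end HalfBell

theorem chooseSeq_induction {k : ℕ} (hk : 0 < k) {Φ : (ℤ → ℝ) → Prop}
    (hadd : ∀ a b : ℤ → ℝ, (support a).Finite → (support b).Finite → Φ a → Φ b →
      Φ fun l => a l + b l)
    (hbell : ∀ c, HalfBell c → Φ c) (hshift : ∀ c, HalfBell c → Φ fun l => c (l - 1))
    (hzero : ∀ a : ℤ → ℝ, (∀ l ≠ 0, a l = 0) → 0 ≤ a 0 → Φ a) (n : ℕ) :
    ∀ M N : ℕ, M + N = n → |(M : ℤ) - N| ≤ k → Φ (chooseSeq k n M) := by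
  induction n with
  | zero =>
    intro M N hMN _
    obtain ⟨rfl, rfl⟩ : M = 0 ∧ N = 0 := by lia
    refine hzero _ (fun l hl => ?_) (chooseSeq_nonneg _ _ _ _)
    exact chooseSeq_eq_zero_of_lt hk (by simpa using hl)
  | succ n ih =>
    intro M N hMN h
    rw [abs_le] at h
    by_cases h1 : (N : ℤ) = M + k
    · exact hbell _ (halfBell_chooseSeq hk (by lia))
    by_cases h2 : (M : ℤ) = N + k
    · rw [h2, show chooseSeq k (n + 1) (N + k) = fun l => chooseSeq k (n + 1) N (l - 1) from
        funext fun l => chooseSeq_add _ _ _ _]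
      exact hshift _ (halfBell_chooseSeq hk (by lia))
    by_cases h0 : M = 0 ∨ N = 0
    · refine hzero _ (fun l hl => ?_) (chooseSeq_nonneg _ _ _ _)
      have : zchoose (n + 1) (M - k * l) = 0 := by
        apply zchoose_eq_zero
        have hk' : (0 : ℤ) < k := by exact_mod_cast hk
        rcases lt_or_gt_of_ne hl with hl | hl
        · right
          have : (k : ℤ) * l ≤ -k := by nlinarith
          push_cast
          lia
        · left
          have : (k : ℤ) ≤ k * l := by nlinarith
          lia
      simp [chooseSeq, this]
    · obtain ⟨M, rfl⟩ := Nat.exists_eq_add_one.2 (by lia : 0 < M)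
      obtain ⟨N, rfl⟩ := Nat.exists_eq_add_one.2 (by lia : 0 < N)
      rw [show chooseSeq k (n + 1) ((M + 1 : ℕ) : ℤ) = fun l =>
        chooseSeq k n ((M + 1 : ℕ) : ℤ) l + chooseSeq k n M l from
        funext fun l => by rw [chooseSeq_succ]; push_cast; rw [add_sub_cancel_right]]
      exact hadd _ _ (finite_support_chooseSeq hk _ _) (finite_support_chooseSeq hk _ _)
        (ih (M + 1) N (by lia) (by rw [abs_le]; push_cast at h h1 h2 ⊢; lia))
        (ih M (N + 1) (by lia) (by rw [abs_le]; push_cast at h h1 h2 ⊢; lia))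

/-- A half bell, or the constant sequence `1`. -/
def HalfBellOrOne (c : ℤ → ℝ) : Prop := HalfBell c ∨ c = fun _ => 1

theorem HalfBellOrOne.nonneg {c : ℤ → ℝ} (hc : HalfBellOrOne c) (l : ℤ) : 0 ≤ c l := by
  rcases hc with hc | rfl
  · exact hc.nonneg l
  · exact zero_le_one

theorem HalfBellOrOne.mul {c d : ℤ → ℝ} (hc : HalfBellOrOne c) (hd : HalfBell d) :
    HalfBell fun l => c l * d l := by
  rcases hc with hc | rfl
  · exact hc.mul hd
  · simpa using hd

theorem tsum_mul_prod_mul_cos_nonneg {ι : Type*} [DecidableEq ι] (k M N : ι → ℕ)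
    (hk : ∀ i, 0 < k i) (h : ∀ i, |(M i : ℤ) - N i| ≤ k i) {x : ℝ} (hx : x ∈ Icc 0 π)
    (s : Finset ι) :
    ∀ c d : ℤ → ℝ, HalfBellOrOne c → HalfBellOrOne d → (HalfBell c ∨ HalfBell d ∨ s.Nonempty) →
      0 ≤ ∑' l : ℤ, c l * d (l - 1) * (∏ i ∈ s, chooseSeq (k i) (M i + N i) (M i) l) *
        cos (l * x) := by
  induction s using Finset.induction_on with
  | empty =>
    intro c d hc hd hcd
    simp only [Finset.prod_empty, mul_one]
    rcases hc with hc | rfl <;> rcases hd with hd | rfl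
    · exact hc.tsum_mul_shift_nonneg hd hx
    · simpa using hc.tsum_nonneg hx
    · simpa using hd.tsum_shift_nonneg hx
    · have hone : ¬ HalfBell fun _ => 1 := fun h => by
        have := h.finite
        rw [support_const one_ne_zero] at this
        exact Set.infinite_univ this
      simp [hone] at hcd
  | insert i s hi ih =>
    intro c d hc hd _
    suffices H : ∀ c d : ℤ → ℝ, HalfBellOrOne c → HalfBellOrOne d →
        0 ≤ ∑' l : ℤ, chooseSeq (k i) (M i + N i) (M i) l *
          (c l * d (l - 1) * (∏ i ∈ s, chooseSeq (k i) (M i + N i) (M i) l) * cos (l * x)) by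
      refine (H c d hc hd).trans_eq (tsum_congr fun l => ?_)
      rw [Finset.prod_insert hi]
      ring
    refine chooseSeq_induction (hk i) (Φ := fun a => ∀ c d : ℤ → ℝ, HalfBellOrOne c →
      HalfBellOrOne d → 0 ≤ ∑' l : ℤ, a l * (c l * d (l - 1) *
        (∏ i ∈ s, chooseSeq (k i) (M i + N i) (M i) l) * cos (l * x)))
      ?_ ?_ ?_ ?_ _ (M i) (N i) rfl (h i)
    · intro a b ha hb hΦa hΦb c d hc hd
      simp_rw [add_mul]
      rw [(summable_mul_of_finite ha _).tsum_add (summable_mul_of_finite hb _)]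
      exact add_nonneg (hΦa c d hc hd) (hΦb c d hc hd)
    · intro a ha c d hc hd
      refine (ih _ d (.inl (hc.mul ha)) hd (.inl (hc.mul ha))).trans_eq (tsum_congr fun l => ?_)
      ring
    · intro a ha c d hc hd
      refine (ih c _ hc (.inl (hd.mul ha)) (.inr (.inl (hd.mul ha)))).trans_eq
        (tsum_congr fun l => ?_)
      ring
    · intro a ha ha0 c d hc hd
      rw [tsum_eq_single 0 fun l hl => by rw [ha l hl, zero_mul]]
      have hprod : 0 ≤ ∏ i ∈ s, chooseSeq (k i) (M i + N i) (M i) 0 :=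
        Finset.prod_nonneg fun _ _ => chooseSeq_nonneg _ _ _ _
      have hc0 := hc.nonneg 0
      have hd0 := hd.nonneg (0 - 1)
      rw [Int.cast_zero, zero_mul, cos_zero]
      positivity

theorem stmt19 (r : ℕ) (hr : 1 ≤ r) (k M N : Fin r → ℕ)
    (hk : ∀ i, 0 < k i) (hM : ∀ i, 0 < M i) (hN : ∀ i, 0 < N i)
    (h : ∀ i, |(M i : ℤ) - N i| ≤ k i) (x : ℝ) :
    0 ≤ ∑ l ∈ Finset.Icc (-(∑ i, ((M i : ℤ) + N i))) (∑ i, ((M i : ℤ) + N i)),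
        (∏ i, (zchoose (M i + N i) ((M i : ℤ) - k i * l) : ℝ)) * Real.cos (l * x) := by
  have hcos : ∀ l : ℤ, cos (l * x) = cos (l * arccos (cos x)) := fun l => by
    rw [← Polynomial.Chebyshev.T_real_cos, ← Polynomial.Chebyshev.T_real_cos,
      cos_arccos (neg_one_le_cos x) (cos_le_one x)]
  have key := tsum_mul_prod_mul_cos_nonneg k M N hk h
    (x := arccos (cos x)) ⟨arccos_nonneg _, arccos_le_pi _⟩ Finset.univ (fun _ => 1) (fun _ => 1)
    (.inr rfl) (.inr rfl) (.inr (.inr ⟨⟨0, hr⟩, Finset.mem_univ _⟩))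
  refine key.trans_eq ?_
  rw [tsum_eq_sum (s := Finset.Icc (-(∑ i, ((M i : ℤ) + N i))) (∑ i, ((M i : ℤ) + N i)))]
  · exact Finset.sum_congr rfl fun l _ => by rw [hcos, one_mul, one_mul]; rfl
  · intro l hl
    have hl' : ∑ i, ((M i : ℤ) + N i) < |l| := by
      rw [Finset.mem_Icc, ← abs_le] at hl
      exact not_le.1 hl
    let i : Fin r := ⟨0, hr⟩
    have hk' : (1 : ℤ) ≤ k i := by exact_mod_cast hk i
    have hle : (M i : ℤ) + N i ≤ ∑ i, ((M i : ℤ) + N i) :=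
      Finset.single_le_sum (f := fun i => (M i : ℤ) + N i) (fun i _ => by positivity)
        (Finset.mem_univ i)
    have hz : zchoose (M i + N i) (M i - k i * l) = 0 := by
      apply zchoose_eq_zero
      rcases le_total 0 l with h0 | h0
      · rw [abs_of_nonneg h0] at hl'
        left
        nlinarith
      · rw [abs_of_nonpos h0] at hl'
        right
        push_cast
        nlinarith
    rw [Finset.prod_eq_zero (Finset.mem_univ i) (by simp [chooseSeq, hz])]
    ring
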